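/- M' contains no induced subgraph isomorphic to the disjoint union P_8 + P_1 such that the 8-vertex path has an endvertex in T = {2, 4, 11, 23} and the isolated vertex lies in T. -/

import Mathlib

open SimpleGraph

/-- An instance of Not-All-Equal 3-Satisfiability with positive literals:
variables are indexed by `Fin n`, and each of the `m` clauses is an ordered
triple of variables. -/
structure NAE (n m : ℕ) where
  clause : Fin m → Fin 3 → Fin n

/-- A truth assignment in which each clause contains at least one true and at
least one false variable. -/
def NAE.Satisfiable {n m : ℕ} (I : NAE n m) : Prop :=
  ∃ τ : Fin n → Bool, ∀ j : Fin m,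
    (∃ h : Fin 3, τ (I.clause j h) = true) ∧ (∃ h : Fin 3, τ (I.clause j h) = false)

/-- Vertices of the graph `J_I`: `a`- and `b`-type vertices of the two clause
components (`p = false` for the unprimed component, `p = true` for the primed
one), and one `x`-type vertex per variable.  The `a`-vertices of a component are
`a j p 0, a j p 1, a j p 2` and its `b`-vertices `b j p 0, b j p 1`; the
component is the induced path `a j p 0 - b j p 0 - a j p 1 - b j p 1 - a j p 2`. -/
inductive JV (n m : ℕ) where
  | a (j : Fin m) (p : Bool) (h : Fin 3)
  | b (j : Fin m) (p : Bool) (h : Fin 2)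
  | x (i : Fin n)

/-- Base relation for the edges of `J_I`. -/
def JRel {n m : ℕ} (I : NAE n m) : JV n m → JV n m → Prop
  | .a j p h, .b j' p' h' => j = j' ∧ p = p' ∧ (h = h'.castSucc ∨ h = h'.succ)
  | .a j _ h, .x i => I.clause j h = i
  | .x _, .b _ _ _ => True
  | _, _ => False

/-- The graph `J_I`. -/
def JGraph {n m : ℕ} (I : NAE n m) : SimpleGraph (JV n m) := fromRel (JRel I)

/-- The 4-list assignment `L` of `J_I`. -/
def Lassign {n m : ℕ} : JV n m → Finset ℕ
  | .a _ p h =>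
      if p then (if h.val = 0 then {1,4} else if h.val = 1 then {1,3,4} else {1,3})
      else (if h.val = 0 then {2,4} else if h.val = 1 then {2,3,4} else {2,3})
  | .b _ _ _ => {3,4}
  | .x _ => {1,2}

/-- Vertices of the graph `J_I'`: those of `J_I` together with the `c`-type
subdivision vertices, one for each edge between an `a`-type and an `x`-type
vertex (i.e., one for each `a`-type vertex `a j p h`, subdividing its edge to
the vertex of the variable `clause j h`). -/
inductive JV' (n m : ℕ) where
  | a (j : Fin m) (p : Bool) (h : Fin 3)
  | b (j : Fin m) (p : Bool) (h : Fin 2)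
  | x (i : Fin n)
  | c (j : Fin m) (p : Bool) (h : Fin 3)

/-- Base relation for the edges of `J_I'`. -/
def J'Rel {n m : ℕ} (I : NAE n m) : JV' n m → JV' n m → Prop
  | .a j p h, .b j' p' h' => j = j' ∧ p = p' ∧ (h = h'.castSucc ∨ h = h'.succ)
  | .c j p h, .a j' p' h' => j = j' ∧ p = p' ∧ h = h'
  | .c j _ h, .x i => I.clause j h = i
  | .x _, .b _ _ _ => True
  | _, _ => False

/-- The graph `J_I'`. -/
def J'Graph {n m : ℕ} (I : NAE n m) : SimpleGraph (JV' n m) := fromRel (J'Rel I)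

/-- The 4-list assignment `L'` of `J_I'`. -/
def L'assign {n m : ℕ} : JV' n m → Finset ℕ
  | .a _ p h =>
      if p then (if h.val = 0 then {1,4} else if h.val = 1 then {1,3,4} else {1,3})
      else (if h.val = 0 then {2,4} else if h.val = 1 then {2,3,4} else {2,3})
  | .b _ _ _ => {3,4}
  | .x _ => {1,2}
  | .c _ _ _ => {1,2}

/-- `a`-type or `x`-type vertices of `J_I'`. -/
def JV'.isAX {n m : ℕ} : JV' n m → Bool
  | .a _ _ _ => true
  | .x _ => true
  | _ => false

/-- `b`-type vertices of `J_I'`. -/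
def JV'.isB {n m : ℕ} : JV' n m → Bool
  | .b _ _ _ => true
  | _ => false

/-- `c`-type vertices of `J_I'`. -/
def JV'.isC {n m : ℕ} : JV' n m → Bool
  | .c _ _ _ => true
  | _ => false

/-- Vertices of the graph `J_I^k`: the vertices of `J_I'` together with, for
each vertex `v` of `J_I'`, exactly `k - |L'(v)|` pendant vertices. -/
inductive JVK (n m k : ℕ) where
  | orig (v : JV' n m)
  | pend (v : JV' n m) (i : Fin (k - (L'assign v).card))

/-- Base relation for the edges of `J_I^k`. -/
def JKRel {n m k : ℕ} (I : NAE n m) : JVK n m k → JVK n m k → Prop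
  | .orig u, .orig v => J'Rel I u v
  | .pend v _, .orig u => u = v
  | _, _ => False

/-- The graph `J_I^k`. -/
def JKGraph {n m : ℕ} (I : NAE n m) (k : ℕ) : SimpleGraph (JVK n m k) :=
  fromRel (JKRel I)

/-- A graph is chordal bipartite if it is bipartite (2-colourable) and has no
induced cycle on any number of vertices other than four. -/
def ChordalBipartite {V : Type*} (G : SimpleGraph V) : Prop :=
  G.Colorable 2 ∧ ∀ s : ℕ, 3 ≤ s → s ≠ 4 → IsEmpty (cycleGraph s ↪g G)

/-- The disjoint union `P_1 + 2P_2` on five vertices: vertex `0` is isolated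
and `1-2`, `3-4` are the two `P_2`s. -/
def P1plus2P2 : SimpleGraph (Fin 5) :=
  fromRel (fun u v => (u = 1 ∧ v = 2) ∨ (u = 3 ∧ v = 4))

/-- The disjoint union `P_1 + P_4` on five vertices: vertex `0` is isolated and
`1-2-3-4` is the `P_4`. -/
def P1plusP4 : SimpleGraph (Fin 5) :=
  fromRel (fun u v => (u = 1 ∧ v = 2) ∨ (u = 2 ∧ v = 3) ∨ (u = 3 ∧ v = 4))

/-- The vertex of `Fin 23` carrying label `i ∈ {1, …, 23}`. -/
def vtx (i : ℕ) : Fin 23 := ⟨(i - 1) % 23, by omega⟩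

/-- The edges (by labels in `{1, …, 23}`) of the graph `M'`, i.e. of the
Mycielski graph `M_5` minus the edge `{17, 23}`. -/
def MpEdges : List (ℕ × ℕ) :=
  [(1,2),(2,3),(3,5),(5,4),(4,1),
   (6,2),(6,4),(7,1),(7,3),(8,2),(8,5),(9,1),(9,5),(10,3),(10,4),
   (11,6),(11,7),(11,8),(11,9),(11,10),
   (12,2),(12,4),(12,7),(12,9),(13,1),(13,3),(13,6),(13,8),
   (14,2),(14,5),(14,7),(14,10),(15,1),(15,5),(15,6),(15,10),
   (16,3),(16,4),(16,8),(16,9),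
   (17,2),(17,4),(17,11),(18,1),(18,3),(18,11),(19,2),(19,5),(19,11),
   (20,1),(20,5),(20,11),(21,3),(21,4),(21,11),
   (22,6),(22,7),(22,8),(22,9),(22,10),
   (12,23),(13,23),(14,23),(15,23),(16,23),(18,23),(19,23),(20,23),(21,23),(22,23)]

/-- The edges (by labels) of the Mycielski graph `M_5`. -/
def M5Edges : List (ℕ × ℕ) := (17,23) :: MpEdges

/-- The Mycielski graph `M_5` on 23 vertices. -/
def M5 : SimpleGraph (Fin 23) :=
  fromRel (fun u v => ∃ e ∈ M5Edges, u = vtx e.1 ∧ v = vtx e.2)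

/-- The graph `M'`, i.e. `M_5` minus the edge `{17, 23}`. -/
def Mp : SimpleGraph (Fin 23) :=
  fromRel (fun u v => ∃ e ∈ MpEdges, u = vtx e.1 ∧ v = vtx e.2)

/-- The vertex set `T = {2, 4, 11, 23}` of `M'`. -/
def Tset : Set (Fin 23) := {vtx 2, vtx 4, vtx 11, vtx 23}

/-- The list of colours `{1,2,3,4} \ L'(v)`, used to precolour the pendant
vertices attached to `v` in `J_I^4`. -/
def complList {n m : ℕ} : JV' n m → List ℕ
  | .a _ p h =>
      if p then (if h.val = 0 then [2,3] else if h.val = 1 then [2] else [2,4])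
      else (if h.val = 0 then [1,3] else if h.val = 1 then [1] else [1,4])
  | .b _ _ _ => [1,2]
  | .x _ => [3,4]
  | .c _ _ _ => [3,4]

/-- The precolouring `c_{W^4}` of the pendant vertices of `J_I^4`: the pendant
vertices attached to `v` receive the distinct colours of `{1,2,3,4} \ L'(v)`. -/
def cW4 {n m : ℕ} (v : JV' n m) (i : Fin (4 - (L'assign v).card)) : ℕ :=
  (complList v).getD i.val 0

/-- The vertex `t_j` of (the copy of) `M'`, for `j ∈ {1,2,3,4}`:
`t_1 = 2`, `t_2 = 4`, `t_3 = 11`, `t_4 = 23`. -/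
def tvert (j : ℕ) : Fin 23 :=
  if j = 1 then vtx 2 else if j = 2 then vtx 4 else if j = 3 then vtx 11 else vtx 23

/-- Vertices of the graph `J*_I`: the vertices of `J_I'`, the pendant vertices
of `J_I^4` attached to `a`- or `x`-type vertices (the vertices pendant to
`B ∪ C` having been removed), and a copy of `M'`. -/
inductive JStarV (n m : ℕ) where
  | orig (v : JV' n m)
  | pend (v : JV' n m) (i : Fin (4 - (L'assign v).card)) (hv : v.isAX = true)
  | mv (t : Fin 23)

/-- Base relation for the edges of `J*_I`. -/
def JStarRel {n m : ℕ} (I : NAE n m) : JStarV n m → JStarV n m → Prop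
  | .orig u, .orig v => J'Rel I u v
  | .pend v _ _, .orig u => u = v
  | .pend v i _, .mv t => ∃ j ∈ ({1,2,3,4} : Finset ℕ), j ≠ cW4 v i ∧ t = tvert j
  | .orig u, .mv t =>
      (u.isB = true ∧ (t = vtx 2 ∨ t = vtx 4)) ∨
      (u.isC = true ∧ (t = vtx 11 ∨ t = vtx 23))
  | .mv s, .mv t => ∃ e ∈ MpEdges, s = vtx e.1 ∧ t = vtx e.2
  | _, _ => False

/-- The graph `J*_I`. -/
def JStar {n m : ℕ} (I : NAE n m) : SimpleGraph (JStarV n m) := fromRel (JStarRel I)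

/-- `b`-type vertices of `J_I^k`. -/
def JVK.isB {n m k : ℕ} : JVK n m k → Bool
  | .orig v => v.isB
  | _ => false

/-- A pendant vertex of `J_I^4 - B`: a vertex with exactly one neighbour among
the non-`b`-type vertices. -/
def PendantOutsideB {n m : ℕ} (I : NAE n m) (v : JVK n m 4) : Prop :=
  ∃! w : JVK n m 4, w.isB = false ∧ (JKGraph I 4).Adj v w


/-- A search for an induced path of `G` that starts in `c` and continues with `k` vertices of `A`,
where `A` is meant to avoid `c`. -/
def hasInducedPathFrom {V : Type*} (G : SimpleGraph V) [DecidableRel G.Adj] :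
    ℕ → V → List V → Bool
  | 0, _, _ => true
  | k + 1, c, A => A.any fun w =>
      decide (G.Adj c w) && hasInducedPathFrom G k w (A.filter fun u => !decide (G.Adj c u))

/-- The path on `n` vertices, as the induced subgraph of the path on `n + 1` vertices that avoids
the first vertex. -/
def pathGraphSucc (n : ℕ) : pathGraph n ↪g pathGraph (n + 1) where
  toEmbedding := Fin.succEmb n
  map_rel_iff' := by
    intro a b
    simp only [pathGraph_adj, Fin.coe_succEmb, Fin.val_succ]
    omega

/-- The reversal of a path. -/
def pathGraphRev (n : ℕ) : pathGraph n ≃g pathGraph n where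
  toEquiv := Fin.revPerm
  map_rel_iff' := by
    intro a b
    simp only [pathGraph_adj, Fin.revPerm_apply, Fin.val_rev]
    omega

theorem hasInducedPathFrom_of_embedding {V : Type*} (G : SimpleGraph V) [DecidableRel G.Adj]
    (k : ℕ) (f : pathGraph (k + 1) ↪g G) (A : List V) (hA : ∀ i : Fin k, f i.succ ∈ A) :
    hasInducedPathFrom G k (f 0) A = true := by
  induction k generalizing A with
  | zero => rfl
  | succ k ih =>
    simp only [hasInducedPathFrom, List.any_eq_true, Bool.and_eq_true, decide_eq_true_eq]
    refine ⟨f (Fin.succ 0), hA 0, ?_, ?_⟩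
    · rw [f.map_adj_iff, pathGraph_adj]
      simp
    · refine ih (f.comp (pathGraphSucc (k + 1))) _ fun i => ?_
      have hi : ¬ G.Adj (f 0) (f i.succ.succ) := by
        rw [f.map_adj_iff, pathGraph_adj]
        simp
      exact List.mem_filter.2 ⟨hA i.succ, by rw [Bool.not_eq_true']; exact decide_eq_false hi⟩

instance : DecidableRel Mp.Adj := fun u v =>
  decidable_of_iff _ (fromRel_adj (fun u v => ∃ e ∈ MpEdges, u = vtx e.1 ∧ v = vtx e.2) u v).symm

theorem Mp_not_hasInducedPathFrom :
    ∀ s ∈ [vtx 2, vtx 4, vtx 11, vtx 23], ∀ v ∈ [vtx 2, vtx 4, vtx 11, vtx 23],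
      hasInducedPathFrom Mp 7 s
        ((List.finRange 23).filter fun u => decide (u ≠ s ∧ u ≠ v ∧ ¬ Mp.Adj u v)) = false := by
  decide +kernel

theorem Mp_no_isolated_of_path_from (f : pathGraph 8 ↪g Mp) (v : Fin 23) (hv : v ∈ Tset)
    (hf : f 0 ∈ Tset) (hne : ∀ i, f i ≠ v) : ∃ i, Mp.Adj (f i) v := by
  by_contra! hadj
  have hfrom := hasInducedPathFrom_of_embedding Mp 7 f
    ((List.finRange 23).filter fun u => decide (u ≠ f 0 ∧ u ≠ v ∧ ¬ Mp.Adj u v)) fun i => by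
      simp [hne, hadj]
  rw [Mp_not_hasInducedPathFrom (f 0) (by simpa [Tset] using hf) v (by simpa [Tset] using hv)]
    at hfrom
  exact Bool.false_ne_true hfrom

/- Statement 11 -/
theorem stmt11 :
    ¬ ∃ (f : pathGraph 8 ↪g Mp) (v : Fin 23),
        v ∈ Tset ∧ (f (0 : Fin 8) ∈ Tset ∨ f (7 : Fin 8) ∈ Tset) ∧
        (∀ i, f i ≠ v) ∧ (∀ i, ¬ Mp.Adj (f i) v) := by
  rintro ⟨f, v, hv, hf | hf, hne, hadj⟩
  · obtain ⟨i, hi⟩ := Mp_no_isolated_of_path_from f v hv hf hne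
    exact hadj i hi
  · obtain ⟨i, hi⟩ := Mp_no_isolated_of_path_from (f.comp (pathGraphRev 8).toEmbedding) v hv hf
      fun i => hne _
    exact hadj _ hi
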